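/- Let β > −1, γ > 0, δ > 0. Then the sequence (−1)^k λ_k is positive and strictly decreasing: for every k ∈ ℕ one has 0 < (−1)^{k+1} λ_{k+1} < (−1)^k λ_k. -/

import Mathlib

/-- The coefficients
`λ_k = ((−1)^k/Γ(γ)) ∫_0^1 (1−z)^{γ−1} z^β (1−z^{1/δ})^k dz`. -/
noncomputable def ekCoeff (β γ δ : ℝ) (k : ℕ) : ℝ :=
  ((-1 : ℝ) ^ k / Real.Gamma γ) *
    ∫ z in (0:ℝ)..1, (1 - z) ^ (γ - 1) * z ^ β * (1 - z ^ (1 / δ)) ^ k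

open MeasureTheory in
lemma intervalIntegrable_one_sub_rpow_mul_rpow {β γ : ℝ} (hβ : -1 < β) (hγ : 0 < γ) :
    IntervalIntegrable (fun z : ℝ => (1 - z) ^ (γ - 1) * z ^ β) volume 0 1 := by
  have h := (Complex.betaIntegral_convergent (u := ((β + 1 : ℝ) : ℂ)) (v := (γ : ℂ))
    (by rw [Complex.ofReal_re]; linarith) (by simpa using hγ)).norm
  refine h.congr_uIoo fun z hz => ?_
  rw [Set.uIoo_of_le zero_le_one] at hz
  have h₁ : (0 : ℝ) < 1 - z := by linarith [hz.2]
  have h₂ : (1 : ℂ) - z = ((1 - z : ℝ) : ℂ) := by push_cast; rfl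
  simp only [norm_mul, h₂, Complex.norm_cpow_eq_rpow_re_of_pos hz.1,
    Complex.norm_cpow_eq_rpow_re_of_pos h₁]
  simp [mul_comm]

open MeasureTheory in
lemma intervalIntegrable_ekCoeff_integrand {β γ δ : ℝ} (hβ : -1 < β) (hγ : 0 < γ) (hδ : 0 < δ)
    (k : ℕ) :
    IntervalIntegrable
      (fun z : ℝ => (1 - z) ^ (γ - 1) * z ^ β * (1 - z ^ (1 / δ)) ^ k) volume 0 1 := by
  refine (intervalIntegrable_one_sub_rpow_mul_rpow hβ hγ).mul_continuousOn ?_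
  have hc : Continuous fun z : ℝ => z ^ (1 / δ) := Real.continuous_rpow_const (by positivity)
  exact ((continuous_const.sub hc).pow k).continuousOn

lemma neg_one_pow_mul_ekCoeff (β γ δ : ℝ) (k : ℕ) :
    (-1 : ℝ) ^ k * ekCoeff β γ δ k =
      (∫ z in (0:ℝ)..1, (1 - z) ^ (γ - 1) * z ^ β * (1 - z ^ (1 / δ)) ^ k) / Real.Gamma γ := by
  have h : (-1 : ℝ) ^ k * (-1) ^ k = 1 := by rw [← mul_pow]; simp
  rw [ekCoeff, ← mul_assoc, ← mul_div_assoc, h, one_div, inv_mul_eq_div]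

/-- the sequence `(−1)^k λ_k` is positive and strictly decreasing. -/
theorem ekCoeff_alternating_strict_anti (β γ δ : ℝ) (hβ : -1 < β) (hγ : 0 < γ) (hδ : 0 < δ) :
    ∀ k : ℕ,
      0 < (-1 : ℝ) ^ (k + 1) * ekCoeff β γ δ (k + 1) ∧
      (-1 : ℝ) ^ (k + 1) * ekCoeff β γ δ (k + 1) < (-1 : ℝ) ^ k * ekCoeff β γ δ k := by
  intro k
  have hΓ := Real.Gamma_pos_of_pos hγ
  have hi := intervalIntegrable_ekCoeff_integrand hβ hγ hδ
  have hweight : ∀ z ∈ Set.Ioo (0 : ℝ) 1, 0 < (1 - z) ^ (γ - 1) * z ^ β := fun z hz =>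
    mul_pos (Real.rpow_pos_of_pos (sub_pos.2 hz.2) _) (Real.rpow_pos_of_pos hz.1 _)
  have hbase : ∀ z ∈ Set.Ioo (0 : ℝ) 1, 0 < 1 - z ^ (1 / δ) := fun z hz =>
    sub_pos.2 (Real.rpow_lt_one hz.1.le hz.2 (by positivity))
  rw [neg_one_pow_mul_ekCoeff, neg_one_pow_mul_ekCoeff]
  constructor
  · refine div_pos (intervalIntegral.intervalIntegral_pos_of_pos_on (hi _) (fun z hz => ?_)
      one_pos) hΓ
    exact mul_pos (hweight z hz) (pow_pos (hbase z hz) _)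
  · refine div_lt_div_of_pos_right ?_ hΓ
    rw [← sub_pos, ← intervalIntegral.integral_sub (hi k) (hi (k + 1))]
    refine intervalIntegral.intervalIntegral_pos_of_pos_on ((hi k).sub (hi (k + 1)))
      (fun z hz => ?_) one_pos
    have h := mul_pos (mul_pos (hweight z hz) (pow_pos (hbase z hz) k))
      (Real.rpow_pos_of_pos hz.1 (1 / δ))
    rw [pow_succ]
    linarith
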